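/- For all integers n ≥ 0 and k ≥ 0, the number of 3-Motzkin paths of length n with exactly k steps H₂ of positive height equals the number of Schröder paths of length 2(n+1) having no peak of odd height and exactly k peaks of even height greater than 2. -/

import Mathlib

/-- Steps of a 3-Motzkin path: `U = (1,1)`, `D = (1,-1)` and three
labeled horizontal steps `H0, H1, H2` (each equal to `(1,0)`). -/
inductive MStep : Type
  | U : MStep
  | D : MStep
  | H0 : MStep
  | H1 : MStep
  | H2 : MStep
  deriving DecidableEq

/-- The contribution of a step to the y-coordinate. -/
def MStep.eff : MStep → ℤ
  | U => 1
  | D => -1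
  | H0 => 0
  | H1 => 0
  | H2 => 0

/-- The height (y-coordinate of the starting point) of the `i`-th step (0-indexed). -/
def mHeight (L : List MStep) (i : ℕ) : ℤ := ((L.take i).map MStep.eff).sum

/-- `L` is a 3-Motzkin path of length `n`: it has `n` steps, ends at height `0`,
and never goes below the x-axis. -/
def IsMotzkin3 (L : List MStep) (n : ℕ) : Prop :=
  L.length = n ∧ (L.map MStep.eff).sum = 0 ∧ ∀ i, 0 ≤ mHeight L i

/-- The number of `H2` steps of `L` of positive height. -/
def posH2Steps (L : List MStep) : ℕ :=
  ((Finset.range L.length).filter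
    (fun i => L[i]? = some MStep.H2 ∧ 0 < mHeight L i)).card

/-- Steps of a Schröder path: `U = (1,1)`, `D = (1,-1)`, `H = H² = (2,0)`. -/
inductive SStep : Type
  | U : SStep
  | D : SStep
  | H : SStep
  deriving DecidableEq

/-- The contribution of a step to the x-coordinate. -/
def SStep.len : SStep → ℕ
  | U => 1
  | D => 1
  | H => 2

/-- The contribution of a step to the y-coordinate. -/
def SStep.eff : SStep → ℤ
  | U => 1
  | D => -1
  | H => 0

/-- The height (y-coordinate of the starting point) of the `i`-th step (0-indexed);
for `i = L.length` this is the final height of the path. -/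
def sHeight (L : List SStep) (i : ℕ) : ℤ := ((L.take i).map SStep.eff).sum

/-- `L` is a Schröder path of length `2 * n`: it has total horizontal displacement `2 * n`,
ends at height `0`, and never goes below the x-axis. -/
def IsSchroder (L : List SStep) (n : ℕ) : Prop :=
  (L.map SStep.len).sum = 2 * n ∧ (L.map SStep.eff).sum = 0 ∧ ∀ i, 0 ≤ sHeight L i

/-- A peak at position `i`: an up step immediately followed by a down step.
The height of this peak is `sHeight L (i+1)`, the height of its down step. -/
def IsPeakAt (L : List SStep) (i : ℕ) : Prop :=
  L[i]? = some SStep.U ∧ L[i+1]? = some SStep.D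

/-- `L` has no peak of odd height. -/
def NoOddPeak (L : List SStep) : Prop :=
  ∀ i, IsPeakAt L i → ¬ Odd (sHeight L (i+1))

/-- `L` has no peak of even height. -/
def NoEvenPeak (L : List SStep) : Prop :=
  ∀ i, IsPeakAt L i → ¬ Even (sHeight L (i+1))

/-- `L` is UH-free: no up step is immediately followed by a horizontal step. -/
def UHFree (L : List SStep) : Prop :=
  ∀ i, ¬ (L[i]? = some SStep.U ∧ L[i+1]? = some SStep.H)

/-- The number of peaks of `L` of even height greater than `2`. -/
def evenHighPeaks (L : List SStep) : ℕ :=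
  ((Finset.range L.length).filter
    (fun i => L[i]? = some SStep.U ∧ L[i+1]? = some SStep.D ∧
      Even (sHeight L (i+1)) ∧ 2 < sHeight L (i+1))).card

/-- `L`, started at height `h`, ends at height `0` and never goes below the x-axis. -/
def MStep.Valid : ℤ → List MStep → Prop
  | h, [] => h = 0
  | h, s :: L => 0 ≤ h ∧ MStep.Valid (h + s.eff) L

/-- The number of `H2` steps of positive height of `L` started at height `h`. -/
def MStep.posH2 : ℤ → List MStep → ℕ
  | _, [] => 0
  | h, s :: L => MStep.posH2 (h + s.eff) L + if s = MStep.H2 ∧ 0 < h then 1 else 0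

/-- `L`, started at height `h`, ends at height `0` and never goes below the x-axis. -/
def SStep.Valid : ℤ → List SStep → Prop
  | h, [] => h = 0
  | h, s :: L => 0 ≤ h ∧ SStep.Valid (h + s.eff) L

/-- `L`, started at height `h`, has no peak of odd height. -/
def SStep.NoOdd : ℤ → List SStep → Prop
  | _, [] => True
  | h, s :: L => (s = SStep.U ∧ L.head? = some SStep.D → ¬ Odd (h + 1)) ∧
      SStep.NoOdd (h + s.eff) L

/-- The number of peaks of even height greater than `2` of `L` started at height `h`. -/
def SStep.highPeaks : ℤ → List SStep → ℕ
  | _, [] => 0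
  | h, s :: L => SStep.highPeaks (h + s.eff) L +
      if s = SStep.U ∧ L.head? = some SStep.D ∧ Even (h + 1) ∧ 2 < h + 1 then 1 else 0

theorem mHeight_cons_succ (s : MStep) (L : List MStep) (i : ℕ) :
    mHeight (s :: L) (i + 1) = s.eff + mHeight L i := by
  simp [mHeight]

theorem sHeight_cons_succ (s : SStep) (L : List SStep) (i : ℕ) :
    sHeight (s :: L) (i + 1) = s.eff + sHeight L i := by
  simp [sHeight]

theorem mHeight_zero (L : List MStep) : mHeight L 0 = 0 := by simp [mHeight]

theorem sHeight_zero (L : List SStep) : sHeight L 0 = 0 := by simp [sHeight]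

theorem MStep.valid_iff (L : List MStep) (h : ℤ) :
    MStep.Valid h L ↔ h + (L.map MStep.eff).sum = 0 ∧ ∀ i, 0 ≤ h + mHeight L i := by
  induction L generalizing h with
  | nil => simp +contextual [MStep.Valid, mHeight]
  | cons s L ih =>
    rw [MStep.Valid, ih, ← Nat.and_forall_add_one (p := fun i => 0 ≤ h + mHeight (s :: L) i)]
    simp only [mHeight_cons_succ, mHeight_zero, List.map_cons, List.sum_cons, add_assoc, add_zero]
    tauto

theorem SStep.valid_iff (L : List SStep) (h : ℤ) :
    SStep.Valid h L ↔ h + (L.map SStep.eff).sum = 0 ∧ ∀ i, 0 ≤ h + sHeight L i := by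
  induction L generalizing h with
  | nil => simp +contextual [SStep.Valid, sHeight]
  | cons s L ih =>
    rw [SStep.Valid, ih, ← Nat.and_forall_add_one (p := fun i => 0 ≤ h + sHeight (s :: L) i)]
    simp only [sHeight_cons_succ, sHeight_zero, List.map_cons, List.sum_cons, add_assoc, add_zero]
    tauto

theorem MStep.posH2_eq (L : List MStep) (h : ℤ) :
    MStep.posH2 h L = ((Finset.range L.length).filter
      (fun i => L[i]? = some MStep.H2 ∧ 0 < h + mHeight L i)).card := by
  induction L generalizing h with
  | nil => simp [MStep.posH2]
  | cons s L ih =>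
    rw [MStep.posH2, ih, Finset.card_filter, Finset.card_filter, List.length_cons,
      Finset.sum_range_succ']
    simp [mHeight_cons_succ, mHeight_zero, add_assoc]

theorem SStep.highPeaks_eq (L : List SStep) (h : ℤ) :
    SStep.highPeaks h L = ((Finset.range L.length).filter
      (fun i => L[i]? = some SStep.U ∧ L[i+1]? = some SStep.D ∧
        Even (h + sHeight L (i+1)) ∧ 2 < h + sHeight L (i+1))).card := by
  induction L generalizing h with
  | nil => simp [SStep.highPeaks]
  | cons s L ih =>
    rw [SStep.highPeaks, ih, Finset.card_filter, Finset.card_filter, List.length_cons,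
      Finset.sum_range_succ']
    congr 1
    · simp [sHeight_cons_succ, add_assoc]
    · cases s <;> simp [sHeight_cons_succ, sHeight_zero, SStep.eff, List.head?_eq_getElem?]

theorem SStep.noOdd_iff (L : List SStep) (h : ℤ) :
    SStep.NoOdd h L ↔ ∀ i, IsPeakAt L i → ¬ Odd (h + sHeight L (i+1)) := by
  induction L generalizing h with
  | nil => simp [SStep.NoOdd, IsPeakAt]
  | cons s L ih =>
    rw [SStep.NoOdd, ih, ← Nat.and_forall_add_one
      (p := fun i => IsPeakAt (s :: L) i → ¬ Odd (h + sHeight (s :: L) (i+1)))]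
    refine and_congr ?_ ?_
    · cases s <;>
        simp [IsPeakAt, sHeight_cons_succ, sHeight_zero, SStep.eff, List.head?_eq_getElem?]
    · simp [IsPeakAt, sHeight_cons_succ, add_assoc]

/-- The Schröder path associated with a 3-Motzkin path.  Each Motzkin step becomes two half steps
joining odd heights (`U ↦ UU`, `D ↦ DD`, `H0 ↦ DU`, `H1 ↦ H`, `H2 ↦ UD`), the whole word is
put between `U` and `D`, and every peak of odd height is replaced by a horizontal step.
The Boolean tells whether an up step from even height is still waiting to be written. -/
def MStep.toSchroder : Bool → List MStep → List SStep
  | true, [] => [.H]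
  | true, .U :: L => .U :: .U :: MStep.toSchroder true L
  | true, .D :: L => .H :: .D :: MStep.toSchroder false L
  | true, .H0 :: L => .H :: MStep.toSchroder true L
  | true, .H1 :: L => .U :: .H :: MStep.toSchroder false L
  | true, .H2 :: L => .U :: .U :: .D :: MStep.toSchroder false L
  | false, [] => [.D]
  | false, .U :: L => .U :: MStep.toSchroder true L
  | false, .D :: L => .D :: .D :: MStep.toSchroder false L
  | false, .H0 :: L => .D :: MStep.toSchroder true L
  | false, .H1 :: L => .H :: MStep.toSchroder false L
  | false, .H2 :: L => .U :: .D :: MStep.toSchroder false L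

/-- The states of the decoder `SStep.toMotzkin`: at odd height, or at even height after an
up step, after a down step, or at the beginning of the path. -/
inductive DecodeState : Type
  | odd : DecodeState
  | up : DecodeState
  | down : DecodeState
  | start : DecodeState

/-- The inverse of `MStep.toSchroder`. -/
def SStep.toMotzkin : DecodeState → List SStep → List MStep
  | _, [] => []
  | .odd, .U :: S => SStep.toMotzkin .up S
  | .odd, .D :: S => SStep.toMotzkin .down S
  | .odd, .H :: S => .H1 :: SStep.toMotzkin .odd S
  | .up, .U :: S => .U :: SStep.toMotzkin .odd S
  | .up, .D :: S => .H2 :: SStep.toMotzkin .odd S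
  | .up, .H :: S => .U :: SStep.toMotzkin .down S
  | .down, .U :: S => .H0 :: SStep.toMotzkin .odd S
  | .down, .D :: S => .D :: SStep.toMotzkin .odd S
  | .down, .H :: S => .H0 :: SStep.toMotzkin .down S
  | .start, .U :: S => SStep.toMotzkin .odd S
  | .start, .D :: S => SStep.toMotzkin .odd S
  | .start, .H :: S => SStep.toMotzkin .down S

namespace MStep

theorem head?_toSchroder_true (L : List MStep) : (toSchroder true L).head? ≠ some .D := by
  rcases L with _ | ⟨_ | _, L⟩ <;> simp [toSchroder]

theorem toMotzkin_toSchroder_aux (L : List MStep) :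
    SStep.toMotzkin .odd (toSchroder false L) = L ∧
    SStep.toMotzkin .up (toSchroder true L) = .U :: L ∧
    SStep.toMotzkin .down (toSchroder true L) = .H0 :: L ∧
    SStep.toMotzkin .start (toSchroder true L) = L := by
  induction L with
  | nil => simp [toSchroder, SStep.toMotzkin]
  | cons s L ih =>
    obtain ⟨h₁, h₂, h₃, h₄⟩ := ih
    cases s <;> simp [toSchroder, SStep.toMotzkin, *]

theorem toSchroder_true_injective : Function.Injective (toSchroder true) :=
  Function.LeftInverse.injective (g := SStep.toMotzkin .start)
    fun L => (toMotzkin_toSchroder_aux L).2.2.2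

theorem sum_len_toSchroder (L : List MStep) :
    ((toSchroder false L).map SStep.len).sum = 2 * L.length + 1 ∧
    ((toSchroder true L).map SStep.len).sum = 2 * (L.length + 1) := by
  induction L with
  | nil => simp [toSchroder, SStep.len]
  | cons s L ih =>
    obtain ⟨h₁, h₂⟩ := ih
    cases s <;> simp [toSchroder, SStep.len, *] <;> omega

theorem valid_toSchroder (L : List MStep) (j : ℤ) :
    (SStep.Valid (2 * j + 1) (toSchroder false L) ↔ Valid j L) ∧
    (SStep.Valid (2 * j) (toSchroder true L) ↔ Valid j L) := by
  induction L generalizing j with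
  | nil => simp [toSchroder, SStep.Valid, Valid, SStep.eff]; omega
  | cons s L ih =>
    have h₀ := ih j
    have h₁ := ih (j + 1)
    have h₂ := ih (j - 1)
    cases s <;> simp only [toSchroder, SStep.Valid, Valid, SStep.eff, MStep.eff] <;> grind

theorem noOdd_toSchroder (L : List MStep) (j : ℤ) :
    SStep.NoOdd (2 * j + 1) (toSchroder false L) ∧
    SStep.NoOdd (2 * j) (toSchroder true L) := by
  induction L generalizing j with
  | nil => simp [toSchroder, SStep.NoOdd]
  | cons s L ih =>
    have h₀ := ih j
    have h₁ := ih (j + 1)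
    have h₂ := ih (j - 1)
    have hd := head?_toSchroder_true L
    cases s <;> simp only [toSchroder, SStep.NoOdd, SStep.eff] <;> grind

theorem highPeaks_toSchroder (L : List MStep) (j : ℤ) :
    SStep.highPeaks (2 * j + 1) (toSchroder false L) = posH2 j L ∧
    SStep.highPeaks (2 * j) (toSchroder true L) = posH2 j L := by
  induction L generalizing j with
  | nil => simp [toSchroder, SStep.highPeaks, posH2]
  | cons s L ih =>
    have h₀ := ih j
    have h₁ := ih (j + 1)
    have h₂ := ih (j - 1)
    have hd := head?_toSchroder_true L
    cases s <;> simp only [toSchroder, SStep.highPeaks, posH2, SStep.eff, MStep.eff] <;> grind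

end MStep

theorem SStep.toSchroder_toMotzkin_aux (S : List SStep) (j : ℤ) :
    (Valid (2 * j + 1) S → NoOdd (2 * j + 1) S →
      MStep.toSchroder false (toMotzkin .odd S) = S ∧
      (S.head? ≠ some .D → MStep.toSchroder true (toMotzkin .odd S) = .U :: S)) ∧
    (Valid (2 * j) S → NoOdd (2 * j) S →
      (MStep.toSchroder false (toMotzkin .down S) = .D :: S ∧
        MStep.toSchroder true (toMotzkin .down S) = .H :: S) ∧
      (j ≠ 0 → MStep.toSchroder false (toMotzkin .up S) = .U :: S ∧
        MStep.toSchroder true (toMotzkin .up S) = .U :: .U :: S)) := by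
  induction S generalizing j with
  | nil => simp [Valid, toMotzkin, MStep.toSchroder]; omega
  | cons s S ih =>
    have h₀ := ih j
    have h₁ := ih (j + 1)
    have h₂ := ih (j - 1)
    cases s <;> simp only [toMotzkin, MStep.toSchroder, Valid, NoOdd, SStep.eff] <;> grind

theorem SStep.toSchroder_toMotzkin {S : List SStep} (hS : S ≠ []) (hv : Valid 0 S)
    (ho : NoOdd 0 S) : MStep.toSchroder true (toMotzkin .start S) = S := by
  rcases S with _ | ⟨_ | _ | _, S⟩
  · contradiction
  · simp only [Valid, NoOdd, SStep.eff] at hv ho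
    refine ((toSchroder_toMotzkin_aux S 0).1 hv.2 ho.2).2 fun h => ?_
    exact ho.1 ⟨trivial, h⟩ (by decide)
  · rcases S with _ | ⟨s, S⟩ <;> simp [Valid, SStep.eff] at hv
  · exact ((toSchroder_toMotzkin_aux S 0).2 hv.2 ho.2).1.2

/-- For all integers `n ≥ 0` and `k ≥ 0`, the number of 3-Motzkin paths of length `n` with
exactly `k` steps `H2` of positive height equals the number of Schröder paths of length
`2 * (n + 1)` having no peak of odd height and exactly `k` peaks of even height greater
than `2`. -/
theorem stmt11 (n k : ℕ) :
    Nat.card {L : List MStep // IsMotzkin3 L n ∧ posH2Steps L = k} =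
    Nat.card {L : List SStep // IsSchroder L (n + 1) ∧ NoOddPeak L ∧
        evenHighPeaks L = k} := by
  have hM (L : List MStep) : IsMotzkin3 L n ∧ posH2Steps L = k ↔
      L.length = n ∧ MStep.Valid 0 L ∧ MStep.posH2 0 L = k := by
    simp [IsMotzkin3, posH2Steps, MStep.valid_iff, MStep.posH2_eq, and_assoc]
  have hS (S : List SStep) : IsSchroder S (n + 1) ∧ NoOddPeak S ∧ evenHighPeaks S = k ↔
      (S.map SStep.len).sum = 2 * (n + 1) ∧ SStep.Valid 0 S ∧ SStep.NoOdd 0 S ∧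
        SStep.highPeaks 0 S = k := by
    simp [IsSchroder, NoOddPeak, evenHighPeaks, SStep.valid_iff, SStep.noOdd_iff,
      SStep.highPeaks_eq, and_assoc]
  have key (L : List MStep) : (IsMotzkin3 L n ∧ posH2Steps L = k) ↔
      IsSchroder (MStep.toSchroder true L) (n + 1) ∧ NoOddPeak (MStep.toSchroder true L) ∧
        evenHighPeaks (MStep.toSchroder true L) = k := by
    have hv := (MStep.valid_toSchroder L 0).2
    have ho := (MStep.noOdd_toSchroder L 0).2
    have hp := (MStep.highPeaks_toSchroder L 0).2
    rw [mul_zero] at hv ho hp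
    rw [hM, hS, (MStep.sum_len_toSchroder L).2, hv, hp]
    simp [ho]
  refine Nat.card_congr (Equiv.ofBijective
    (fun L => ⟨MStep.toSchroder true L.1, (key L.1).1 L.2⟩) ⟨fun L L' h => ?_, fun S => ?_⟩)
  · exact Subtype.ext (MStep.toSchroder_true_injective (congrArg Subtype.val h))
  · obtain ⟨hlen, hv, ho, -⟩ := (hS S.1).1 S.2
    have hne : S.1 ≠ [] := by
      intro h
      simp [h] at hlen
    have h := SStep.toSchroder_toMotzkin hne hv ho
    exact ⟨⟨SStep.toMotzkin .start S.1, (key _).2 (h.symm ▸ S.2)⟩, Subtype.ext h⟩
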